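/- arXiv:1310.8061 — 2 statements merged into one kernel-verified Lean document; each statement's English description precedes it below -/
import Mathlib

section
/- Let {φ_r} be a regular approximation of identity on 𝕋 consisting of even functions, λ(r) → 0 as r → 1, and suppose γ_λ := lim_{τ→1}( limsup_{δ→0} sup_{τ<r<1} ∫_{-δλ(r)}^{δλ(r)} φ_r ) > 0. Then there exists a measurable set E ⊂ 𝕋 such that, for every x ∈ 𝕋, the family Φ_r(θ, 𝟙_E) = ∫_𝕋 φ_r(θ-t) 𝟙_E(t) dt fails to λ(r)-converge at x, i.e., limsup_{r→1} osc_{θ∈[x-λ(r),x+λ(r)]} Φ_r(θ, 𝟙_E) > 0. -/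
open MeasureTheory Real Set Filter Topology


/-- The periodic union of half-open intervals of radius `d` around the net `hℤ`. -/
def netU (h d : ℝ) : Set ℝ := {y | ∃ j : ℤ, j * h - d ≤ y ∧ y < j * h + d}

/-- Closed `d`-neighbourhood of the nonzero multiples of `η`. -/
def netV (η d : ℝ) : Set ℝ := {s | ∃ j : ℤ, j ≠ 0 ∧ |s - j * η| ≤ d}

structure NiceSet (F : Set ℝ) : Prop where
  meas : MeasurableSet F
  per : ∀ y, (y + 2 * π ∈ F ↔ y ∈ F)
  loc : ∀ z, ∃ R > 0, ∃ A B : Prop, ∀ y, |y - z| < R →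
    (y < z → (y ∈ F ↔ A)) ∧ (z ≤ y → (y ∈ F ↔ B))

lemma netU_meas (h d : ℝ) : MeasurableSet (netU h d) := by
  have : netU h d = ⋃ j : ℤ, Set.Ico (j * h - d) (j * h + d) := by
    ext y; simp [netU]
  rw [this]
  exact MeasurableSet.iUnion fun j => measurableSet_Ico

lemma netV_meas (h d : ℝ) : MeasurableSet (netV h d) := by
  have : netV h d = ⋃ j : {j : ℤ // j ≠ 0}, Metric.closedBall ((j : ℤ) * h) d := by
    ext y; simp [netV, Real.dist_eq]
  rw [this]
  exact MeasurableSet.iUnion fun j => Metric.isClosed_closedBall.measurableSet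

lemma netU_per (h d : ℝ) (N : ℕ) (hN : N * h = 2 * π) (y : ℝ) :
    y + 2 * π ∈ netU h d ↔ y ∈ netU h d := by
  constructor
  · rintro ⟨j, h1, h2⟩
    refine ⟨j - N, ?_, ?_⟩ <;> push_cast <;> linarith
  · rintro ⟨j, h1, h2⟩
    refine ⟨j + N, ?_, ?_⟩ <;> push_cast <;> linarith

lemma netU_iff {h d : ℝ} (hh : 0 < h) (hd : 2 * d < h) (m : ℤ) {y : ℝ}
    (h1 : m * h ≤ y + d) (h2 : y + d < (m + 1) * h) : y ∈ netU h d ↔ y + d < m * h + 2 * d := by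
  constructor
  · rintro ⟨j, h3, h4⟩
    have e1 : (j : ℝ) < m + 1 := by
      by_contra hc
      push Not at hc
      nlinarith
    have e2 : (m : ℝ) < j + 1 := by
      by_contra hc
      push Not at hc
      nlinarith
    have e3 : j < m + 1 := by exact_mod_cast e1
    have e4 : m < j + 1 := by exact_mod_cast e2
    have : j = m := by omega
    subst this
    linarith
  · intro h3
    exact ⟨m, by linarith, by linarith⟩

lemma netU_nice {h d : ℝ} (hh : 0 < h) (hd : 2 * d < h) (N : ℕ) (hN : N * h = 2 * π) :
    NiceSet (netU h d) := by
  refine ⟨netU_meas h d, netU_per h d N hN, ?_⟩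
  intro z
  have right : ∃ R > 0, ∃ B : Prop, ∀ y, |y - z| < R → z ≤ y → (y ∈ netU h d ↔ B) := by
    set m := ⌊(z + d) / h⌋ with hm
    have m1 : m * h ≤ z + d := by
      have := Int.floor_le ((z + d) / h)
      rwa [le_div_iff₀ hh] at this
    have m2 : z + d < (m + 1) * h := by
      have := Int.lt_floor_add_one ((z + d) / h)
      rwa [div_lt_iff₀ hh] at this
    by_cases hc : z + d < m * h + 2 * d
    · refine ⟨m * h + 2 * d - (z + d), by linarith, True, fun y hy hzy => ?_⟩
      have := abs_lt.1 hy
      rw [netU_iff hh hd m (by linarith) (by nlinarith)]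
      simp only [iff_true]; linarith
    · refine ⟨(m + 1) * h - (z + d), by linarith, False, fun y hy hzy => ?_⟩
      have := abs_lt.1 hy
      rw [netU_iff hh hd m (by linarith) (by nlinarith)]
      simp only [iff_false]; linarith
  have left : ∃ R > 0, ∃ B : Prop, ∀ y, |y - z| < R → y < z → (y ∈ netU h d ↔ B) := by
    set m := ⌈(z + d) / h⌉ - 1 with hm
    have m1 : m * h < z + d := by
      have := Int.ceil_lt_add_one ((z + d) / h)
      have h2 : (m : ℝ) < (z + d) / h := by rw [hm]; push_cast; linarith
      rwa [lt_div_iff₀ hh] at h2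
    have m2 : z + d ≤ (m + 1) * h := by
      have := Int.le_ceil ((z + d) / h)
      have h2 : (z + d) / h ≤ m + 1 := by rw [hm]; push_cast; linarith
      rwa [div_le_iff₀ hh] at h2
    by_cases hc : z + d ≤ m * h + 2 * d
    · refine ⟨z + d - m * h, by linarith, True, fun y hy hzy => ?_⟩
      have := abs_lt.1 hy
      rw [netU_iff hh hd m (by linarith) (by nlinarith)]
      simp only [iff_true]; linarith
    · refine ⟨min (z + d - m * h) (z + d - (m * h + 2 * d)),
        lt_min (by linarith) (by linarith), False, fun y hy hzy => ?_⟩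
      have h1 := abs_lt.1 (hy.trans_le (min_le_left _ _))
      have h2 := abs_lt.1 (hy.trans_le (min_le_right _ _))
      rw [netU_iff hh hd m (by linarith) (by nlinarith)]
      simp only [iff_false]; linarith
  obtain ⟨R1, hR1, B, hB⟩ := right
  obtain ⟨R2, hR2, A, hA⟩ := left
  refine ⟨min R1 R2, lt_min hR1 hR2, A, B, fun y hy => ⟨fun h => ?_, fun h => ?_⟩⟩
  · exact hA y (hy.trans_le (min_le_right _ _)) h
  · exact hB y (hy.trans_le (min_le_left _ _)) h

lemma nice_empty : NiceSet ∅ :=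
  ⟨MeasurableSet.empty, by simp, fun z => ⟨1, one_pos, False, False, by simp⟩⟩

lemma nice_symmDiff {F G : Set ℝ} (hF : NiceSet F) (hG : NiceSet G) : NiceSet (symmDiff F G) := by
  refine ⟨hF.meas.symmDiff hG.meas, ?_, ?_⟩
  · intro y
    simp only [Set.mem_symmDiff, hF.per, hG.per]
  · intro z
    obtain ⟨R1, hR1, A1, B1, h1⟩ := hF.loc z
    obtain ⟨R2, hR2, A2, B2, h2⟩ := hG.loc z
    refine ⟨min R1 R2, lt_min hR1 hR2, (A1 ∧ ¬ A2) ∨ (A2 ∧ ¬ A1), (B1 ∧ ¬ B2) ∨ (B2 ∧ ¬ B1),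
      fun y hy => ⟨fun h => ?_, fun h => ?_⟩⟩
    · have e1 := (h1 y (hy.trans_le (min_le_left _ _))).1 h
      have e2 := (h2 y (hy.trans_le (min_le_right _ _))).1 h
      simp only [Set.mem_symmDiff, e1, e2]
    · have e1 := (h1 y (hy.trans_le (min_le_left _ _))).2 h
      have e2 := (h2 y (hy.trans_le (min_le_right _ _))).2 h
      simp only [Set.mem_symmDiff, e1, e2]

lemma nice_per_int {F : Set ℝ} (hF : NiceSet F) (n : ℤ) (y : ℝ) :
    y + n * (2 * π) ∈ F ↔ y ∈ F := by
  have hp : Function.Periodic (fun y => y ∈ F) (2 * π) := fun y => propext (hF.per y)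
  have := hp.int_mul n y
  simpa using this

lemma nice_uniform {F : Set ℝ} (hF : NiceSet F) : ∃ ρ > 0, ρ ≤ 1 ∧ ∀ x, ∃ z, ∃ A B : Prop,
    ∀ y, |y - x| < ρ → (y < z → (y ∈ F ↔ A)) ∧ (z ≤ y → (y ∈ F ↔ B)) := by
  choose R hR A B hAB using hF.loc
  obtain ⟨δ, hδ, hδ2⟩ := lebesgue_number_lemma_of_metric (s := Icc (-π) π)
    (c := fun z : ℝ => Metric.ball z (R z)) isCompact_Icc (fun z => Metric.isOpen_ball)
    (fun x _ => mem_iUnion.2 ⟨x, Metric.mem_ball_self (hR x)⟩)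
  refine ⟨min δ 1, lt_min hδ one_pos, min_le_right _ _, fun x => ?_⟩
  obtain ⟨n, hn, -⟩ := existsUnique_add_zsmul_mem_Ico (by positivity : (0:ℝ) < 2 * π) x (-π)
  simp only [zsmul_eq_mul] at hn
  have hx0 : x + n * (2 * π) ∈ Icc (-π) π := ⟨hn.1, by have := hn.2; linarith⟩
  obtain ⟨z, hz⟩ := hδ2 _ hx0
  refine ⟨z - n * (2 * π), A z, B z, fun y hy => ?_⟩
  have hy2 : y + n * (2 * π) ∈ Metric.ball z (R z) := by
    apply hz
    rw [Metric.mem_ball, Real.dist_eq]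
    have : y + n * (2 * π) - (x + n * (2 * π)) = y - x := by ring
    rw [this]
    exact hy.trans_le (min_le_left _ _)
  rw [Metric.mem_ball, Real.dist_eq] at hy2
  have := hAB z _ hy2
  rw [nice_per_int hF] at this
  exact ⟨fun h => this.1 (by linarith), fun h => this.2 (by linarith)⟩

lemma intInt_of_bdd {f : ℝ → ℝ} (hm : Measurable f) {M : ℝ} (hM : ∀ t, |f t| ≤ M) (a b : ℝ) :
    IntervalIntegrable f volume a b := by
  rw [intervalIntegrable_iff]
  apply Measure.integrableOn_of_bounded (M := M)
  · simp [Set.uIoc]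
  · exact hm.aestronglyMeasurable
  · exact Eventually.of_forall hM

lemma ind_bdd (S : Set ℝ) (y : ℝ) : |S.indicator (fun _ => (1:ℝ)) y| ≤ 1 := by
  classical
  rw [Set.indicator_apply]; split_ifs <;> simp

lemma ind_nonneg (S : Set ℝ) (y : ℝ) : 0 ≤ S.indicator (fun _ => (1:ℝ)) y := by
  classical
  rw [Set.indicator_apply]; split_ifs <;> simp

lemma ind_meas {S : Set ℝ} (hS : MeasurableSet S) :
    Measurable (S.indicator (fun _ => (1:ℝ))) := measurable_const.indicator hS

lemma netV_sum {η d : ℝ} {K : ℕ} (hd : 0 < d) (hK : 3 * K * d ≤ η) (u : ℝ) :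
    ∑ i ∈ Finset.range K, (netV η d).indicator (fun _ => (1:ℝ)) (u + 3 * d * i) ≤ 1 := by
  classical
  by_cases hex : ∃ i ∈ Finset.range K, u + 3 * d * i ∈ netV η d
  · obtain ⟨i, hi, hiV⟩ := hex
    rw [Finset.sum_eq_single_of_mem i hi]
    · exact (le_abs_self _).trans (ind_bdd _ _)
    · intro i' hi' hne
      apply Set.indicator_of_notMem
      intro hV
      have key : ∀ a b : ℕ, a < b → b < K → u + 3 * d * a ∈ netV η d →
          u + 3 * d * b ∈ netV η d → False := by
        rintro a b hab hbK ⟨j, -, h1⟩ ⟨j', -, h2⟩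
        rw [abs_le] at h1 h2
        have e1 : (a:ℝ) + 1 ≤ b := by exact_mod_cast hab
        have e2 : (b:ℝ) + 1 ≤ K := by exact_mod_cast hbK
        have ha : (0:ℝ) ≤ a := Nat.cast_nonneg a
        have e3 : d * (a + 1) ≤ d * b := by gcongr
        have e4 : d * (b + 1) ≤ d * K := by gcongr
        have e5 : 0 ≤ d * a := by positivity
        have hη : 0 < η := by nlinarith
        rcases lt_trichotomy j j' with h | h | h
        · have : (j:ℝ) + 1 ≤ j' := by exact_mod_cast h
          have : (j + 1) * η ≤ j' * η := by gcongr
          nlinarith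
        · subst h; nlinarith
        · have : (j':ℝ) + 1 ≤ j := by exact_mod_cast h
          have : (j' + 1) * η ≤ j * η := by gcongr
          nlinarith
      rw [Finset.mem_range] at hi hi'
      rcases lt_or_gt_of_ne hne with h | h
      · exact key _ _ h hi hV hiV
      · exact key _ _ h hi' hiV hV
  · push Not at hex
    rw [Finset.sum_eq_zero]
    · exact zero_le_one
    · intro i hi
      exact Set.indicator_of_notMem (hex i hi) _

lemma netV_neg {η d s : ℝ} (h : -s ∈ netV η d) : s ∈ netV η d := by
  obtain ⟨j, hj, h1⟩ := h
  refine ⟨-j, by simpa using hj, ?_⟩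
  rw [← abs_neg]; push_cast
  convert h1 using 2
  ring

lemma netV_half {k : ℝ → ℝ} (hm : Measurable k) {M : ℝ} (hM : ∀ t, |k t| ≤ M)
    (h0 : ∀ t, 0 ≤ k t) (hdec : AntitoneOn k (Icc 0 π)) {η d : ℝ} {K : ℕ} (hd : 0 < d)
    (hK : 3 * K * d ≤ η) (hK1 : 1 ≤ K) :
    K * ∫ t in (0:ℝ)..π, k t * (netV η d).indicator (fun _ => (1:ℝ)) t ≤ ∫ t in (0:ℝ)..π, k t := by
  classical
  set I := (netV η d).indicator (fun _ => (1:ℝ)) with hI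
  have hImeas : Measurable I := ind_meas (netV_meas _ _)
  set k0 := (Ioc 0 π).indicator k with hk0
  have hk0m : Measurable k0 := hm.indicator measurableSet_Ioc
  have hk0i : Integrable k0 := by
    rw [hk0, integrable_indicator_iff measurableSet_Ioc]
    have := (intInt_of_bdd hm hM 0 π).1
    simpa using this
  have hk0n : ∀ u, 0 ≤ k0 u := fun u => Set.indicator_nonneg (fun _ _ => h0 _) u
  have hL : ∫ t in (0:ℝ)..π, k t = ∫ u, k0 u := by
    rw [intervalIntegral.integral_of_le pi_pos.le, hk0, integral_indicator measurableSet_Ioc]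
  have hprod : ∀ c : ℝ, Integrable (fun u => I (u + c) * k0 u) := by
    intro c
    refine hk0i.bdd_mul (c := 1) ?_ ?_
    · exact (hImeas.comp (measurable_id.add_const c)).aestronglyMeasurable
    · exact Eventually.of_forall fun u => ind_bdd _ _
  have hR : ∫ t in (0:ℝ)..π, k t * I t = ∫ u, I u * k0 u := by
    rw [intervalIntegral.integral_of_le pi_pos.le, ← integral_indicator measurableSet_Ioc]
    congr 1; ext u
    simp only [hk0, Set.indicator_apply]
    split_ifs <;> ring
  have hKη : d < η := by
    have : (1:ℝ) ≤ K := by exact_mod_cast hK1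
    nlinarith
  have hi : ∀ i ∈ Finset.range K, ∫ u, I u * k0 u ≤ ∫ u, I (u + 3 * d * i) * k0 u := by
    intro i hi
    have e := integral_add_right_eq_self (μ := volume)
      (fun u => I u * k0 (u - 3 * d * i)) (3 * d * i)
    simp only [add_sub_cancel_right] at e
    rw [e]
    have hshift : Integrable (fun u => I u * k0 (u - 3 * d * i)) := by
      have := (hprod (3 * d * i)).comp_sub_right (3 * d * i)
      simpa using this
    refine integral_mono (by simpa using hprod 0) hshift ?_
    intro s
    by_cases hs : s ∈ netV η d
    · simp only [hI, Set.indicator_of_mem hs, one_mul]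
      by_cases hs2 : s ∈ Ioc 0 π
      · obtain ⟨j, hj, h1⟩ := hs
        rw [abs_le] at h1
        have hi2 : (i:ℝ) + 1 ≤ K := by exact_mod_cast Finset.mem_range.1 hi
        have hin : (0:ℝ) ≤ i := Nat.cast_nonneg i
        have e4 : d * (i + 1) ≤ d * K := by gcongr
        have e5 : 0 ≤ d * i := by positivity
        have hj1 : (1:ℤ) ≤ j := by
          by_contra hc
          have : j ≤ -1 := by omega
          have : (j:ℝ) ≤ -1 := by exact_mod_cast this
          have : j * η ≤ (-1) * η := by
            apply mul_le_mul_of_nonneg_right this; linarith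
          linarith [hs2.1]
        have hj2 : (1:ℝ) ≤ j := by exact_mod_cast hj1
        have : 1 * η ≤ j * η := by
          apply mul_le_mul_of_nonneg_right hj2; linarith
        have hmem : s - 3 * d * i ∈ Ioc 0 π := ⟨by nlinarith, by nlinarith [hs2.2]⟩
        rw [hk0, Set.indicator_of_mem hs2, Set.indicator_of_mem hmem]
        exact hdec ⟨hmem.1.le, hmem.2⟩ ⟨hs2.1.le, hs2.2⟩ (by nlinarith)
      · rw [hk0, Set.indicator_of_notMem hs2]
        exact hk0n _
    · simp [hI, Set.indicator_of_notMem hs]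
  rw [hR, hL]
  calc (K:ℝ) * ∫ u, I u * k0 u = ∑ i ∈ Finset.range K, ∫ u, I u * k0 u := by simp
    _ ≤ ∑ i ∈ Finset.range K, ∫ u, I (u + 3 * d * i) * k0 u := Finset.sum_le_sum hi
    _ = ∫ u, ∑ i ∈ Finset.range K, I (u + 3 * d * i) * k0 u := by
        rw [integral_finsetSum _ fun i _ => hprod _]
    _ ≤ ∫ u, k0 u := by
        refine integral_mono (integrable_finsetSum _ fun i _ => hprod _) hk0i fun u => ?_
        simp only
        rw [← Finset.sum_mul]
        have := netV_sum hd hK u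
        nlinarith [hk0n u]

lemma even_integral {f : ℝ → ℝ} (hf : ∀ t, f (-t) = f t) (hi : ∀ a b, IntervalIntegrable f volume a b) :
    ∫ t in (-π)..π, f t = 2 * ∫ t in (0:ℝ)..π, f t := by
  rw [← intervalIntegral.integral_add_adjacent_intervals (hi (-π) 0) (hi 0 π)]
  have := intervalIntegral.integral_comp_neg f (a := 0) (b := π)
  simp only [hf, neg_zero] at this
  rw [← this]; ring

lemma netV_full {k : ℝ → ℝ} (hm : Measurable k) {M : ℝ} (hM : ∀ t, |k t| ≤ M)
    (h0 : ∀ t, 0 ≤ k t) (heven : ∀ t, k (-t) = k t)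
    (hdec : AntitoneOn k (Icc 0 π)) {η d : ℝ} {K : ℕ} (hd : 0 < d)
    (hK : 3 * K * d ≤ η) (hK1 : 1 ≤ K) :
    K * ∫ t in (-π)..π, k t * (netV η d).indicator (fun _ => (1:ℝ)) t ≤ ∫ t in (-π)..π, k t := by
  classical
  rw [even_integral heven (intInt_of_bdd hm hM), even_integral]
  · have := netV_half hm hM h0 hdec hd hK hK1
    linarith
  · intro t
    rw [heven]
    congr 1
    have : -t ∈ netV η d ↔ t ∈ netV η d := ⟨netV_neg, fun h => netV_neg (by simpa using h)⟩
    simp only [Set.indicator_apply, this]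
  · refine intInt_of_bdd (hm.mul (ind_meas (netV_meas _ _))) (M := M) fun t => ?_
    rw [abs_mul]
    have := ind_bdd (netV η d) t
    have := hM t
    nlinarith [abs_nonneg (k t), abs_nonneg ((netV η d).indicator (fun _ => (1:ℝ)) t)]


open Classical in
lemma pw_comb (f1 f2 u1 u2 a a' v t b : Prop) (h1 : a → u1) (h1' : a → a') (h2 : u2 → v)
    (h3 : u1 → a' ∨ v) (h4 : a' → ¬ t ∧ (f1 ↔ b) ∧ (f2 ↔ b)) (h5 : ¬ t → ((f2 ↔ b) ∨ (f1 ↔ f2))) :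
    (if a then (1:ℝ) else 0) - 2 * (if v then 1 else 0) - (if t then 1 else 0) ≤
    (if b then -1 else 1) * ((if (f1 ∧ ¬ u1) ∨ (u1 ∧ ¬ f1) then 1 else 0) -
      (if (f2 ∧ ¬ u2) ∨ (u2 ∧ ¬ f2) then 1 else 0)) := by
  by_cases v <;> by_cases t <;> by_cases a <;> by_cases a' <;> by_cases b <;> by_cases f1 <;>
    by_cases f2 <;> by_cases u1 <;> by_cases u2 <;> simp_all <;> norm_num

lemma pw_dir {F : Set ℝ} {h d x z ρ l e : ℝ} {A B b : Prop} {m : ℤ} (he : e = 1 ∨ e = -1)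
    (hd : 0 < d) (hdh : 2 * d < h) (hl : 5 / 2 * h ≤ l) (hρ : l < ρ / 2)
    (hm1 : h ≤ e * (m * h - x)) (hm2 : e * (m * h - x) ≤ 2 * h)
    (hloc : ∀ y, |y - x| < ρ → (y < z → (y ∈ F ↔ A)) ∧ (z ≤ y → (y ∈ F ↔ B)))
    (hz : (e = 1 ∧ z ≤ x ∧ (b ↔ B)) ∨ (e = -1 ∧ x < z ∧ (b ↔ A))) :
    ∃ θ θ' σ : ℝ, |σ| = 1 ∧ |θ - x| ≤ l ∧ |θ' - x| ≤ l ∧ ∀ s,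
      {s : ℝ | |s| < d}.indicator (fun _ => (1:ℝ)) s
        - 2 * (netV (h / 2) d).indicator (fun _ => (1:ℝ)) s
        - {s : ℝ | ρ / 2 ≤ |s|}.indicator (fun _ => (1:ℝ)) s ≤
      σ * ((symmDiff F (netU h d)).indicator (fun _ => (1:ℝ)) (θ - s) -
        (symmDiff F (netU h d)).indicator (fun _ => (1:ℝ)) (θ' - s)) := by
  classical
  have hb1 : |m * h - x| ≤ l := by
    rw [abs_le]; rcases he with rfl | rfl <;> constructor <;> linarith
  have hb2 : |m * h + e * (h / 2) - x| ≤ l := by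
    rw [abs_le]; rcases he with rfl | rfl <;> constructor <;> linarith
  refine ⟨m * h, m * h + e * (h / 2), if b then -1 else 1, by split_ifs <;> simp, hb1, hb2, ?_⟩
  intro s
  simp only [Set.indicator_apply, Set.mem_symmDiff, Set.mem_ofPred_eq]
  refine pw_comb _ _ _ _ _ (|s| ≤ d) _ _ b ?_ ?_ ?_ ?_ ?_ ?_
  · intro hs
    rw [abs_lt] at hs
    exact ⟨m, by linarith, by linarith⟩
  · exact le_of_lt
  · rintro ⟨j, h1, h2⟩
    rcases he with rfl | rfl
    · refine ⟨2 * (m - j) + 1, by omega, ?_⟩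
      rw [abs_le]; push_cast; constructor <;> linarith
    · refine ⟨2 * (m - j) - 1, by omega, ?_⟩
      rw [abs_le]; push_cast; constructor <;> linarith
  · rintro ⟨j, h1, h2⟩
    by_cases hj : m = j
    · left
      subst hj
      rw [abs_le]; constructor <;> linarith
    · right
      refine ⟨2 * (m - j), by omega, ?_⟩
      rw [abs_le]; push_cast; constructor <;> linarith
  · intro hs
    rw [abs_le] at hs hb1 hb2
    refine ⟨?_, ?_⟩
    · rw [not_le, abs_lt]; constructor <;> linarith
    · have r1 := hloc (m * h - s) (by rw [abs_lt]; constructor <;> linarith)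
      have r2 := hloc (m * h + e * (h / 2) - s) (by rw [abs_lt]; constructor <;> linarith)
      rcases hz with ⟨rfl, hz, hb⟩ | ⟨rfl, hz, hb⟩
      · rw [hb]
        exact ⟨r1.2 (by linarith), r2.2 (by linarith)⟩
      · rw [hb]
        exact ⟨r1.1 (by linarith), r2.1 (by linarith)⟩
  · intro hs
    rw [not_le, abs_lt] at hs
    rw [abs_le] at hb1 hb2
    have r1 := hloc (m * h - s) (by rw [abs_lt]; constructor <;> linarith)
    have r2 := hloc (m * h + e * (h / 2) - s) (by rw [abs_lt]; constructor <;> linarith)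
    rcases hz with ⟨rfl, hz, hb⟩ | ⟨rfl, hz, hb⟩
    · rcases lt_or_ge (m * h + 1 * (h / 2) - s) z with hc | hc
      · right
        rw [r1.1 (by linarith), r2.1 hc]
      · left
        rw [r2.2 hc, hb]
    · rcases lt_or_ge (m * h + (-1) * (h / 2) - s) z with hc | hc
      · left
        rw [r2.1 hc, hb]
      · right
        rw [r1.2 (by linarith), r2.2 hc]

lemma pw_all {F : Set ℝ} {h d x z ρ l : ℝ} {A B : Prop}
    (hd : 0 < d) (hdh : 2 * d < h) (hl : 5 / 2 * h ≤ l) (hρ : l < ρ / 2)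
    (hloc : ∀ y, |y - x| < ρ → (y < z → (y ∈ F ↔ A)) ∧ (z ≤ y → (y ∈ F ↔ B))) :
    ∃ θ θ' σ : ℝ, |σ| = 1 ∧ |θ - x| ≤ l ∧ |θ' - x| ≤ l ∧ ∀ s,
      {s : ℝ | |s| < d}.indicator (fun _ => (1:ℝ)) s
        - 2 * (netV (h / 2) d).indicator (fun _ => (1:ℝ)) s
        - {s : ℝ | ρ / 2 ≤ |s|}.indicator (fun _ => (1:ℝ)) s ≤
      σ * ((symmDiff F (netU h d)).indicator (fun _ => (1:ℝ)) (θ - s) -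
        (symmDiff F (netU h d)).indicator (fun _ => (1:ℝ)) (θ' - s)) := by
  have hh : 0 < h := by linarith
  have f1 := Int.floor_le (x / h)
  have f2 := Int.lt_floor_add_one (x / h)
  rw [le_div_iff₀ hh] at f1
  rw [div_lt_iff₀ hh] at f2
  rcases le_or_gt z x with hz | hz
  · refine pw_dir (e := 1) (m := ⌊x / h⌋ + 2) (b := B) (Or.inl rfl) hd hdh hl hρ ?_ ?_ hloc
      (Or.inl ⟨rfl, hz, Iff.rfl⟩) <;> push_cast <;> linarith
  · refine pw_dir (e := -1) (m := ⌊x / h⌋ - 1) (b := A) (Or.inr rfl) hd hdh hl hρ ?_ ?_ hloc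
      (Or.inr ⟨rfl, hz, Iff.rfl⟩) <;> push_cast <;> linarith

lemma mulind_int {k : ℝ → ℝ} (hm : Measurable k) {M : ℝ} (hM : ∀ t, |k t| ≤ M)
    {g : ℝ → ℝ} (hg : Measurable g) (hg1 : ∀ t, |g t| ≤ 1) (a b : ℝ) :
    IntervalIntegrable (fun t => k t * g t) volume a b := by
  refine intInt_of_bdd (f := fun t => k t * g t) (hm.mul hg) (M := M) (fun t => ?_) a b
  rw [abs_mul]
  nlinarith [abs_nonneg (k t), abs_nonneg (g t), hM t, hg1 t]

lemma conv_eq {k : ℝ → ℝ} (hper : ∀ t, k (t + 2 * π) = k t) {F : Set ℝ} (hF : NiceSet F) (θ : ℝ) :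
    ∫ t in (-π)..π, k (θ - t) * F.indicator (fun _ => (1:ℝ)) t =
    ∫ s in (-π)..π, k s * F.indicator (fun _ => (1:ℝ)) (θ - s) := by
  classical
  have h1 := intervalIntegral.integral_comp_sub_left (a := -π) (b := π)
    (fun s => k s * F.indicator (fun _ => (1:ℝ)) (θ - s)) θ
  simp only [sub_sub_cancel] at h1
  rw [h1]
  have hp : Function.Periodic (fun s => k s * F.indicator (fun _ => (1:ℝ)) (θ - s)) (2 * π) := by
    intro s
    simp only [hper, Set.indicator_apply]
    have : θ - s ∈ F ↔ θ - (s + 2 * π) ∈ F := by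
      rw [← hF.per (θ - (s + 2 * π))]
      ring_nf
    simp only [this]
  have := hp.intervalIntegral_add_eq (θ - π) (-π)
  convert this using 2 <;> ring

lemma core {k : ℝ → ℝ} (hm : Measurable k) (hper : ∀ t, k (t + 2 * π) = k t)
    {M : ℝ} (hM : ∀ t, |k t| ≤ M)
    (h0 : ∀ t, 0 ≤ k t) (heven : ∀ t, k (-t) = k t)
    (hdec : AntitoneOn k (Icc 0 π)) {F : Set ℝ} (hF : NiceSet F) {h d x z ρ l γ : ℝ} {A B : Prop}
    {K N : ℕ} (hN : N * h = 2 * π) (hγ : 0 < γ) (hKγ : 16 ≤ γ * K) (hK : 3 * K * d ≤ h / 2)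
    (hd : 0 < d) (hdπ : d ≤ π) (hl : 5 / 2 * h ≤ l) (hρ : l < ρ / 2)
    (hloc : ∀ y, |y - x| < ρ → (y < z → (y ∈ F ↔ A)) ∧ (z ≤ y → (y ∈ F ↔ B)))
    (hmass : ∫ t in (-π)..π, k t ≤ 2) (hnear : γ ≤ ∫ t in (-d)..d, k t)
    (htail : ∫ t in (-π)..π, k t * {s : ℝ | ρ / 2 ≤ |s|}.indicator (fun _ => (1:ℝ)) t ≤ γ / 4) :
    ∃ θ θ', |θ - x| ≤ l ∧ |θ' - x| ≤ l ∧
      γ / 2 ≤ |(∫ t in (-π)..π, k (θ - t) *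
        (symmDiff F (netU h d)).indicator (fun _ => (1 : ℝ)) t) -
        (∫ t in (-π)..π, k (θ' - t) *
        (symmDiff F (netU h d)).indicator (fun _ => (1 : ℝ)) t)| := by
  have hK0 : (0:ℝ) < K := by
    by_contra hc
    push Not at hc
    nlinarith
  have hK1 : 1 ≤ K := by exact_mod_cast hK0
  have hK1' : (1:ℝ) ≤ K := by exact_mod_cast hK1
  have hdh : 2 * d < h := by nlinarith
  have hh : 0 < h := by linarith
  obtain ⟨θ, θ', σ, hσ, hθ, hθ', hpw⟩ := pw_all hd hdh hl hρ hloc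
  refine ⟨θ, θ', hθ, hθ', ?_⟩
  have hF' := nice_symmDiff hF (netU_nice hh hdh N hN)
  rw [conv_eq hper hF', conv_eq hper hF']
  set F' := symmDiff F (netU h d)
  have hV := netV_full hm hM h0 heven hdec (η := h / 2) hd hK hK1
  have md : MeasurableSet {s : ℝ | |s| < d} :=
    (isOpen_lt continuous_abs continuous_const).measurableSet
  have mt : MeasurableSet {s : ℝ | ρ / 2 ≤ |s|} :=
    (isClosed_le continuous_const continuous_abs).measurableSet
  have i1 := mulind_int hm hM (ind_meas md) (ind_bdd _) (-π) π
  have i2 := mulind_int hm hM (ind_meas (netV_meas (h / 2) d)) (ind_bdd _) (-π) π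
  have i3 := mulind_int hm hM (ind_meas mt) (ind_bdd _) (-π) π
  have i4 : ∀ θ, IntervalIntegrable (fun s => k s * F'.indicator (fun _ => (1:ℝ)) (θ - s))
      volume (-π) π := fun θ =>
    mulind_int hm hM ((ind_meas hF'.meas).comp (measurable_const.sub measurable_id))
      (fun _ => ind_bdd _ _) (-π) π
  have hle : γ ≤ ∫ t in (-π)..π, k t * {s : ℝ | |s| < d}.indicator (fun _ => (1:ℝ)) t := by
    refine hnear.trans ?_
    have e1 : ∫ t in (-d)..d, k t =
        ∫ t in (-d)..d, k t * {s : ℝ | |s| < d}.indicator (fun _ => (1:ℝ)) t := by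
      rw [intervalIntegral.integral_of_le (by linarith), intervalIntegral.integral_of_le (by linarith),
        integral_Ioc_eq_integral_Ioo, integral_Ioc_eq_integral_Ioo]
      refine setIntegral_congr_fun measurableSet_Ioo fun s hs => ?_
      have : s ∈ {s : ℝ | |s| < d} := abs_lt.2 hs
      simp only [Set.indicator_of_mem this, mul_one]
    rw [e1]
    refine intervalIntegral.integral_mono_interval (by linarith) (by linarith) hdπ ?_ i1
    exact Eventually.of_forall fun t => mul_nonneg (h0 t) (ind_nonneg _ _)
  have hVle : 2 * ∫ t in (-π)..π, k t * (netV (h / 2) d).indicator (fun _ => (1:ℝ)) t ≤ γ / 4 := by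
    set v := ∫ t in (-π)..π, k t * (netV (h / 2) d).indicator (fun _ => (1:ℝ)) t
    have : K * v ≤ 2 := hV.trans hmass
    have : K * (2 * v) ≤ K * (γ / 4) := by nlinarith
    exact le_of_mul_le_mul_left this hK0
  have hmono : (∫ t in (-π)..π, k t * {s : ℝ | |s| < d}.indicator (fun _ => (1:ℝ)) t) -
      2 * (∫ t in (-π)..π, k t * (netV (h / 2) d).indicator (fun _ => (1:ℝ)) t) -
      (∫ t in (-π)..π, k t * {s : ℝ | ρ / 2 ≤ |s|}.indicator (fun _ => (1:ℝ)) t) ≤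
      σ * ((∫ s in (-π)..π, k s * F'.indicator (fun _ => (1:ℝ)) (θ - s)) -
        ∫ s in (-π)..π, k s * F'.indicator (fun _ => (1:ℝ)) (θ' - s)) := by
    rw [← intervalIntegral.integral_const_mul, ← intervalIntegral.integral_sub i1 (i2.const_mul 2),
      ← intervalIntegral.integral_sub (i1.sub (i2.const_mul 2)) i3,
      ← intervalIntegral.integral_sub (i4 θ) (i4 θ'), ← intervalIntegral.integral_const_mul]
    refine intervalIntegral.integral_mono_on (by linarith [pi_pos])
      ((i1.sub (i2.const_mul 2)).sub i3) (((i4 θ).sub (i4 θ')).const_mul σ) fun s _ => ?_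
    have := mul_le_mul_of_nonneg_left (hpw s) (h0 s)
    linarith
  have := (le_abs_self _).trans_eq (abs_mul σ ((∫ s in (-π)..π, k s * F'.indicator (fun _ => (1:ℝ)) (θ - s)) -
        ∫ s in (-π)..π, k s * F'.indicator (fun _ => (1:ℝ)) (θ' - s)))
  rw [hσ, one_mul] at this
  linarith


lemma netU_vol {h d : ℝ} {N : ℕ} (hh : 0 < h) (hd : 0 < d) (hdh : 2 * d < h)
    (hN : N * h = 2 * π) :
    volume (netU h d ∩ Ioc (-π) π) ≤ ENNReal.ofReal ((2 * N + 1) * (2 * d)) := by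
  have hsub : netU h d ∩ Ioc (-π) π ⊆
      ⋃ j ∈ Finset.Icc (-(N:ℤ)) N, Ico ((j:ℝ) * h - d) (j * h + d) := by
    rintro y ⟨⟨j, h1, h2⟩, h3, h4⟩
    simp only [mem_iUnion]
    refine ⟨j, ?_, h1, h2⟩
    have e1 : (j:ℝ) < N + 1 := by
      by_contra hc
      push Not at hc
      nlinarith [pi_pos]
    have e2 : -((N:ℝ) + 1) < j := by
      by_contra hc
      push Not at hc
      nlinarith [pi_pos]
    have e3 : j < N + 1 := by exact_mod_cast e1
    have e4 : -((N:ℤ) + 1) < j := by exact_mod_cast e2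
    rw [Finset.mem_Icc]; omega
  refine (measure_mono hsub).trans ((measure_biUnion_finset_le _ _).trans ?_)
  simp only [Real.volume_Ico]
  have : ∀ j : ℤ, (j:ℝ) * h + d - (j * h - d) = 2 * d := fun j => by ring
  simp only [this, Finset.sum_const, Int.card_Icc]
  have e : ((N:ℤ) + 1 - -(N:ℤ)).toNat = 2 * N + 1 := by omega
  refine le_of_eq ?_
  rw [e, nsmul_eq_mul, ← ENNReal.ofReal_natCast, ← ENNReal.ofReal_mul (by positivity)]
  push_cast
  rfl

lemma perturb {k : ℝ → ℝ} (hm : Measurable k) {M : ℝ} (hM : ∀ t, |k t| ≤ M)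
    {F G : Set ℝ} (hF : MeasurableSet F) (hG : MeasurableSet G) {ε : ℝ} (hε : 0 ≤ ε)
    (hv : volume (symmDiff F G ∩ Ioc (-π) π) ≤ ENNReal.ofReal ε) (θ : ℝ) :
    |(∫ t in (-π)..π, k (θ - t) * F.indicator (fun _ => (1 : ℝ)) t) -
      (∫ t in (-π)..π, k (θ - t) * G.indicator (fun _ => (1 : ℝ)) t)| ≤ M * ε := by
  classical
  have hM0 : 0 ≤ M := (abs_nonneg _).trans (hM 0)
  have hmθ : Measurable fun t => k (θ - t) := hm.comp (measurable_const.sub measurable_id)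
  have iF := mulind_int hmθ (fun t => hM (θ - t)) (ind_meas hF) (ind_bdd _) (-π) π
  have iG := mulind_int hmθ (fun t => hM (θ - t)) (ind_meas hG) (ind_bdd _) (-π) π
  have hS : MeasurableSet (symmDiff F G) := hF.symmDiff hG
  rw [← intervalIntegral.integral_sub iF iG]
  have hle : (-π) ≤ π := by linarith [pi_pos]
  have h1 : |∫ t in (-π)..π, (k (θ - t) * F.indicator (fun _ => (1 : ℝ)) t -
      k (θ - t) * G.indicator (fun _ => (1 : ℝ)) t)| ≤
      ∫ t in (-π)..π, M * (symmDiff F G).indicator (fun _ => (1 : ℝ)) t := by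
    rw [← Real.norm_eq_abs]
    refine intervalIntegral.norm_integral_le_of_norm_le hle (Eventually.of_forall fun t _ => ?_) ?_
    · rw [Real.norm_eq_abs, ← mul_sub, abs_mul]
      have := hM (θ - t)
      simp only [Set.indicator_apply, Set.mem_symmDiff]
      by_cases t ∈ F <;> by_cases t ∈ G <;> simp_all
    · exact (intInt_of_bdd (ind_meas hS) (ind_bdd _) _ _).const_mul M
  refine h1.trans ?_
  rw [intervalIntegral.integral_const_mul]
  refine mul_le_mul_of_nonneg_left ?_ hM0
  rw [intervalIntegral.integral_of_le hle, integral_indicator_const _ hS, smul_eq_mul, mul_one,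
    Measure.real, Measure.restrict_apply hS]
  exact ENNReal.toReal_le_of_le_ofReal hε hv

lemma tail_le {k : ℝ → ℝ} (hm : Measurable k) {M : ℝ} (hM : ∀ t, |k t| ≤ M) {ρ c : ℝ}
    (hc : 0 ≤ c)
    (hs : sSup {s : ℝ | ∃ t, ρ ≤ |t| ∧ |t| ≤ π ∧ s = |k t|} ≤ c) :
    ∫ t in (-π)..π, k t * {s : ℝ | ρ ≤ |s|}.indicator (fun _ => (1:ℝ)) t ≤ 2 * π * c := by
  classical
  have hle : (-π) ≤ π := by linarith [pi_pos]
  have mt : MeasurableSet {s : ℝ | ρ ≤ |s|} :=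
    (isClosed_le continuous_const continuous_abs).measurableSet
  have i3 := mulind_int hm hM (ind_meas mt) (ind_bdd _) (-π) π
  have := intervalIntegral.integral_mono_on (g := fun _ => c) hle i3 (by simp) (fun t ht => by
    by_cases h : t ∈ {s : ℝ | ρ ≤ |s|}
    · rw [Set.indicator_of_mem h, mul_one]
      refine (le_abs_self _).trans (le_trans ?_ hs)
      refine le_csSup ⟨M, ?_⟩ ⟨t, h, abs_le.2 ht, rfl⟩
      rintro _ ⟨t, -, -, rfl⟩
      exact hM t
    · rw [Set.indicator_of_notMem h, mul_zero]; exact hc)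
  refine this.trans (le_of_eq ?_)
  rw [intervalIntegral.integral_const, smul_eq_mul]; ring

/-- Uniform oscillation at level `r`. -/
def OscGood (φ : ℝ → ℝ → ℝ) (lam : ℝ → ℝ) (r c : ℝ) (E : Set ℝ) : Prop :=
  ∀ x : ℝ, ∃ θ θ', |θ - x| ≤ lam r ∧ |θ' - x| ≤ lam r ∧
          c ≤ |(∫ t in (-π)..π, φ r (θ - t) * Set.indicator E (fun _ => (1 : ℝ)) t) -
               (∫ t in (-π)..π, φ r (θ' - t) * Set.indicator E (fun _ => (1 : ℝ)) t)|

set_option maxHeartbeats 800000 in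
lemma step
    (φ : ℝ → ℝ → ℝ) (lam : ℝ → ℝ)
    (hmeas : ∀ r ∈ Set.Ioo (0 : ℝ) 1, Measurable (φ r))
    (hper : ∀ r ∈ Set.Ioo (0 : ℝ) 1, ∀ t, φ r (t + 2 * π) = φ r t)
    (hbdd : ∀ r ∈ Set.Ioo (0 : ℝ) 1, ∃ M, ∀ t, |φ r t| ≤ M)
    (hnonneg : ∀ r ∈ Set.Ioo (0 : ℝ) 1, ∀ t, 0 ≤ φ r t)
    (heven : ∀ r ∈ Set.Ioo (0 : ℝ) 1, ∀ t, φ r (-t) = φ r t)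
    (hdec : ∀ r ∈ Set.Ioo (0 : ℝ) 1, AntitoneOn (φ r) (Set.Icc 0 π))
    (hAI1 : Tendsto (fun r => ∫ t in (-π)..π, φ r t) (𝓝[<] (1 : ℝ)) (𝓝 1))
    (hAI2 : ∀ x ∈ Set.Ioo (0 : ℝ) π,
      Tendsto (fun r => sSup {s : ℝ | ∃ t, x ≤ |t| ∧ |t| ≤ π ∧ s = |φ r t|})
        (𝓝[<] (1 : ℝ)) (𝓝 0))
    (hlampos : ∀ r ∈ Set.Ioo (0 : ℝ) 1, 0 < lam r)
    (hlam0 : Tendsto lam (𝓝[<] (1 : ℝ)) (𝓝 0))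
    {γ : ℝ} (hγ : 0 < γ)
    (hgamma : ∀ τ ∈ Set.Ioo (0 : ℝ) 1, ∀ δ > 0, ∃ r ∈ Set.Ioo τ 1,
      γ ≤ ∫ t in (-(δ * lam r))..(δ * lam r), φ r t)
    {F : Set ℝ} (hF : NiceSet F) {ε : ℝ} (hε : 0 < ε) {τ : ℝ} (hτ : τ ∈ Ioo (0:ℝ) 1) :
    ∃ F' : Set ℝ, ∃ r ε' : ℝ, NiceSet F' ∧ r ∈ Ioo τ 1 ∧ 0 < ε' ∧ ε' ≤ ε / 2 ∧
      volume (symmDiff F F' ∩ Ioc (-π) π) ≤ ENNReal.ofReal (ε / 2) ∧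
      ∀ G, MeasurableSet G → volume (symmDiff F' G ∩ Ioc (-π) π) ≤ ENNReal.ofReal ε' →
        OscGood φ lam r (γ / 4) G := by
  obtain ⟨ρ, hρ, hρ1, hloc⟩ := nice_uniform hF
  obtain ⟨K, hKγ'⟩ := exists_nat_ge (16 / γ)
  have hKγ : 16 ≤ γ * K := by
    rw [div_le_iff₀ hγ] at hKγ'; linarith
  have hK0 : (0:ℝ) < K := by
    by_contra hc
    push Not at hc
    nlinarith
  have hpi := pi_pos
  have hpi3 := pi_gt_three
  have hev : ∀ᶠ r in 𝓝[<] (1:ℝ), (∫ t in (-π)..π, φ r t) < 2 ∧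
      sSup {s : ℝ | ∃ t, ρ / 2 ≤ |t| ∧ |t| ≤ π ∧ s = |φ r t|} < γ / (8 * π) ∧ lam r < ρ / 2 := by
    refine (hAI1.eventually (gt_mem_nhds (by norm_num))).and
      (((hAI2 (ρ / 2) ⟨by linarith, by linarith⟩).eventually (gt_mem_nhds (by positivity))).and
        (hlam0.eventually (gt_mem_nhds (by linarith))))
  obtain ⟨τ', hτ'1, hτ'⟩ := (mem_nhdsLT_iff_exists_Ioo_subset).1 hev
  simp only [mem_Iio] at hτ'1
  set δ := min (1 / (48 * (K:ℝ))) (ε / (200 * π)) with hδ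
  have hδ0 : 0 < δ := lt_min (by positivity) (by positivity)
  obtain ⟨r, ⟨hr1, hr2⟩, hnear⟩ := hgamma (max τ τ')
    ⟨lt_max_of_lt_left hτ.1, max_lt hτ.2 hτ'1⟩ δ hδ0
  have hrτ : τ < r := (le_max_left _ _).trans_lt hr1
  have hr01 : r ∈ Ioo (0:ℝ) 1 := ⟨hτ.1.trans hrτ, hr2⟩
  obtain ⟨hmass, htl, hlr⟩ := hτ' ⟨(le_max_right _ _).trans_lt hr1, hr2⟩
  have hl0 := hlampos r hr01
  obtain ⟨M, hM⟩ := hbdd r hr01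
  set l := lam r with hl
  set N := ⌈8 * π / l⌉₊ with hNdef
  have hN1 : 8 * π / l ≤ N := Nat.le_ceil _
  have hN2 : (N:ℝ) < 8 * π / l + 1 := Nat.ceil_lt_add_one (by positivity)
  have hq : 1 ≤ 8 * π / l := by
    rw [le_div_iff₀ hl0]; linarith
  have hN0 : (0:ℝ) < N := by linarith
  set h := 2 * π / N with hh
  have hNh : N * h = 2 * π := by rw [hh]; field_simp
  have hh0 : 0 < h := by positivity
  have hN1' : 8 * π ≤ N * l := by rwa [div_le_iff₀ hl0] at hN1
  have hN2' : N * l ≤ 16 * π := by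
    have : (N:ℝ) ≤ 16 * π / l := by
      have e : 16 * π / l = 8 * π / l + 8 * π / l := by ring
      linarith
    rwa [le_div_iff₀ hl0] at this
  have hhl : h ≤ l / 4 := by
    rw [hh, div_le_iff₀ hN0]; linarith
  have hlh : l / 8 ≤ h := by
    rw [hh, le_div_iff₀ hN0]; linarith
  set d := δ * l with hd
  have hd0 : 0 < d := by positivity
  have hKd : 3 * K * d ≤ h / 2 := by
    have e1 : δ ≤ 1 / (48 * (K:ℝ)) := min_le_left _ _
    rw [le_div_iff₀ (by positivity)] at e1
    have : δ * (48 * K) * l ≤ 1 * l := mul_le_mul_of_nonneg_right e1 hl0.le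
    rw [hd]; nlinarith
  have hK1 : (1:ℝ) ≤ K := by exact_mod_cast hK0
  have hdh : 2 * d < h := by nlinarith
  have hM0 : 0 ≤ M := (abs_nonneg _).trans (hM 0)
  have hvol : volume (symmDiff F (symmDiff F (netU h d)) ∩ Ioc (-π) π) ≤ ENNReal.ofReal (ε / 2) := by
    rw [symmDiff_symmDiff_cancel_left]
    refine (netU_vol hh0 hd0 hdh hNh).trans (ENNReal.ofReal_le_ofReal ?_)
    have e2 : δ ≤ ε / (200 * π) := min_le_right _ _
    rw [le_div_iff₀ (by positivity)] at e2
    have : (1:ℝ) ≤ N := by exact_mod_cast hN0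
    have e3 : (2 * N + 1) * (2 * d) ≤ 6 * (N * l) * δ := by rw [hd]; nlinarith
    nlinarith
  refine ⟨symmDiff F (netU h d), r, min (ε / 2) (γ / (8 * (M + 1))),
    nice_symmDiff hF (netU_nice hh0 hdh N hNh), ⟨hrτ, hr2⟩, lt_min (by positivity) (by positivity),
    min_le_left _ _, hvol, ?_⟩
  intro G hG hv x
  set ε' := min (ε / 2) (γ / (8 * (M + 1))) with hε'
  have hε'0 : 0 < ε' := lt_min (by positivity) (by positivity)
  have hMε : M * ε' ≤ γ / 8 := by
    have e1 : ε' ≤ γ / (8 * (M + 1)) := min_le_right _ _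
    rw [le_div_iff₀ (by positivity)] at e1
    linarith
  have hF' := nice_symmDiff hF (netU_nice hh0 hdh N hNh)
  obtain ⟨z, A, B, hzAB⟩ := hloc x
  have htail := tail_le (hmeas r hr01) hM (by positivity) htl.le
  have htail' : ∫ t in (-π)..π, φ r t * {s : ℝ | ρ / 2 ≤ |s|}.indicator (fun _ => (1:ℝ)) t ≤ γ / 4 := by
    refine htail.trans (le_of_eq ?_)
    field_simp; norm_num
  obtain ⟨θ, θ', h1, h2, h3⟩ := core (hmeas r hr01) (hper r hr01) hM (hnonneg r hr01)
    (heven r hr01) (hdec r hr01) hF hNh hγ hKγ hKd hd0 (by linarith)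
    (by linarith) hlr hzAB hmass.le hnear htail'
  refine ⟨θ, θ', h1, h2, ?_⟩
  have p1 := perturb (hmeas r hr01) hM hF'.meas hG hε'0.le hv θ
  have p2 := perturb (hmeas r hr01) hM hF'.meas hG hε'0.le hv θ'
  set a := ∫ t in (-π)..π, φ r (θ - t) * (symmDiff F (netU h d)).indicator (fun _ => (1 : ℝ)) t
  set b := ∫ t in (-π)..π, φ r (θ' - t) * (symmDiff F (netU h d)).indicator (fun _ => (1 : ℝ)) t
  set a' := ∫ t in (-π)..π, φ r (θ - t) * G.indicator (fun _ => (1 : ℝ)) t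
  set b' := ∫ t in (-π)..π, φ r (θ' - t) * G.indicator (fun _ => (1 : ℝ)) t
  have t1 : |a - b| ≤ |a - a'| + |a' - b'| + |b - b'| := by
    have e : a - b = (a - a') + (a' - b') + (-(b - b')) := by ring
    rw [e, ← abs_neg (b - b')]
    exact abs_add_three _ _ _
  linarith

lemma iterate_sets (P : ℕ → Set ℝ → ℝ → Prop)
    (hstep : ∀ n F, NiceSet F → ∀ ε > 0, ∃ F' : Set ℝ, ∃ r ε' : ℝ, NiceSet F' ∧ 0 < ε' ∧
      ε' ≤ ε / 2 ∧ volume (symmDiff F F' ∩ Ioc (-π) π) ≤ ENNReal.ofReal (ε / 2) ∧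
      ∀ G, MeasurableSet G → volume (symmDiff F' G ∩ Ioc (-π) π) ≤ ENNReal.ofReal ε' → P n G r) :
    ∃ E : Set ℝ, MeasurableSet E ∧ E ⊆ Ioc (-π) π ∧ ∃ r : ℕ → ℝ, ∀ n, P n E (r n) := by
  choose! F' r e hN he he2 hv hP using hstep
  let S : ℕ → Set ℝ × ℝ := fun n => Nat.rec (∅, 1) (fun n p => (F' n p.1 p.2, e n p.1 p.2)) n
  have hS1 : ∀ n, S (n + 1) = (F' n (S n).1 (S n).2, e n (S n).1 (S n).2) := fun n => rfl
  have hS : ∀ n, NiceSet (S n).1 ∧ 0 < (S n).2 := by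
    intro n
    induction n with
    | zero => exact ⟨nice_empty, one_pos⟩
    | succ n ih =>
      rw [hS1]
      exact ⟨hN n _ ih.1 _ ih.2, he n _ ih.1 _ ih.2⟩
  have hhalf : ∀ n m, (S (n + m)).2 ≤ (S n).2 / 2 ^ m := by
    intro n m
    induction m with
    | zero => simp
    | succ m ih =>
      have : (S (n + m + 1)).2 ≤ (S (n + m)).2 / 2 := by
        rw [hS1]
        exact he2 _ _ (hS _).1 _ (hS _).2
      rw [← add_assoc, pow_succ, ← div_div]
      linarith
  have hvol : ∀ n, volume (symmDiff (S n).1 (S (n + 1)).1 ∩ Ioc (-π) π) ≤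
      ENNReal.ofReal ((S n).2 / 2) := fun n => hv n _ (hS n).1 _ (hS n).2
  set E0 : Set ℝ := ⋃ n, ⋂ m, (S (n + m)).1 with hE0
  have hE0m : MeasurableSet E0 :=
    MeasurableSet.iUnion fun n => MeasurableSet.iInter fun m => (hS _).1.meas
  have hsub : ∀ n, symmDiff (S n).1 (E0 ∩ Ioc (-π) π) ∩ Ioc (-π) π ⊆
      ⋃ m, symmDiff (S (n + m)).1 (S (n + m + 1)).1 ∩ Ioc (-π) π := by
    rintro n y ⟨hy1, hy2⟩
    by_contra hc
    simp only [mem_iUnion, not_exists] at hc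
    have hc' : ∀ m, (y ∈ (S (n + m)).1 ↔ y ∈ (S n).1) := by
      intro m
      induction m with
      | zero => rfl
      | succ m ih =>
        rw [← ih, ← add_assoc]
        have := hc m
        simp only [mem_inter_iff, hy2, and_true, Set.mem_symmDiff] at this
        tauto
    have hE : y ∈ E0 ↔ y ∈ (S n).1 := by
      simp only [hE0, mem_iUnion, mem_iInter]
      constructor
      · rintro ⟨a, ha⟩
        have := ha n
        rw [add_comm, hc'] at this
        exact this
      · intro h
        exact ⟨n, fun m => (hc' m).2 h⟩
    simp only [Set.mem_symmDiff, mem_inter_iff, hy2, and_true, hE] at hy1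
    tauto
  have hbound : ∀ n, volume (symmDiff (S n).1 (E0 ∩ Ioc (-π) π) ∩ Ioc (-π) π) ≤
      ENNReal.ofReal (S n).2 := by
    intro n
    refine (measure_mono (hsub n)).trans ((measure_iUnion_le _).trans ?_)
    have hpos := (hS n).2
    calc _ ≤ ∑' m : ℕ, ENNReal.ofReal ((S n).2 / 2 / 2 ^ m) := by
          refine ENNReal.tsum_le_tsum fun m => (hvol (n + m)).trans (ENNReal.ofReal_le_ofReal ?_)
          have := hhalf n m
          rw [div_right_comm]
          linarith
      _ = ENNReal.ofReal (∑' m : ℕ, ((S n).2 / 2 / 2 ^ m)) := by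
          rw [ENNReal.ofReal_tsum_of_nonneg (fun m => by positivity) (summable_geometric_two' _)]
      _ = _ := by rw [tsum_geometric_two']
  refine ⟨E0 ∩ Ioc (-π) π, hE0m.inter measurableSet_Ioc, inter_subset_right,
    fun n => r n (S n).1 (S n).2, fun n => ?_⟩
  exact hP n _ (hS n).1 _ (hS n).2 _ (hE0m.inter measurableSet_Ioc) (hbound (n + 1))
/-- Theorem 6: for a regular approximation of identity of even kernels
with `γ_λ > 0`, there is a measurable set `E ⊆ 𝕋` such that the convolutions
`Φ_r(θ, 𝟙_E)` fail to `λ(r)`-converge at every point `x`: the oscillation of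
`Φ_r(·, 𝟙_E)` over `[x - λ(r), x + λ(r)]` does not tend to `0`. -/
theorem divergence_everywhere_gamma_positive
    (φ : ℝ → ℝ → ℝ) (lam : ℝ → ℝ)
    (hmeas : ∀ r ∈ Set.Ioo (0 : ℝ) 1, Measurable (φ r))
    (hper : ∀ r ∈ Set.Ioo (0 : ℝ) 1, ∀ t, φ r (t + 2 * π) = φ r t)
    (hbdd : ∀ r ∈ Set.Ioo (0 : ℝ) 1, ∃ M, ∀ t, |φ r t| ≤ M)
    (hnonneg : ∀ r ∈ Set.Ioo (0 : ℝ) 1, ∀ t, 0 ≤ φ r t)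
    (heven : ∀ r ∈ Set.Ioo (0 : ℝ) 1, ∀ t, φ r (-t) = φ r t)
    (hdec : ∀ r ∈ Set.Ioo (0 : ℝ) 1, AntitoneOn (φ r) (Set.Icc 0 π))
    (hAI1 : Tendsto (fun r => ∫ t in (-π)..π, φ r t) (𝓝[<] (1 : ℝ)) (𝓝 1))
    (hAI2 : ∀ x ∈ Set.Ioo (0 : ℝ) π,
      Tendsto (fun r => sSup {s : ℝ | ∃ t, x ≤ |t| ∧ |t| ≤ π ∧ s = |φ r t|})
        (𝓝[<] (1 : ℝ)) (𝓝 0))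
    (hlampos : ∀ r ∈ Set.Ioo (0 : ℝ) 1, 0 < lam r)
    (hlam0 : Tendsto lam (𝓝[<] (1 : ℝ)) (𝓝 0))
    -- `γ_λ > 0`, unfolded: some `γ > 0` is exceeded by `sup_{τ<r<1} ∫_{-δλ(r)}^{δλ(r)} φ_r`
    -- for every `τ < 1` and every `δ > 0`.
    (hgamma : ∃ γ > 0, ∀ τ ∈ Set.Ioo (0 : ℝ) 1, ∀ δ > 0, ∃ r ∈ Set.Ioo τ 1,
      γ ≤ ∫ t in (-(δ * lam r))..(δ * lam r), φ r t) :
    ∃ E : Set ℝ, MeasurableSet E ∧ E ⊆ Set.Ioc (-π) π ∧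
      ∀ x : ℝ, ∃ c > 0, ∃ᶠ r in 𝓝[<] (1 : ℝ),
        ∃ θ θ', |θ - x| ≤ lam r ∧ |θ' - x| ≤ lam r ∧
          c ≤ |(∫ t in (-π)..π, φ r (θ - t) * Set.indicator E (fun _ => (1 : ℝ)) t) -
               (∫ t in (-π)..π, φ r (θ' - t) * Set.indicator E (fun _ => (1 : ℝ)) t)| := by
  obtain ⟨γ, hγ, hg⟩ := hgamma
  obtain ⟨E, hE, hEs, r, hr⟩ := iterate_sets
    (fun n G r => r ∈ Ioo (1 - 1 / ((n:ℝ) + 2)) 1 ∧ OscGood φ lam r (γ / 4) G) (by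
      intro n F hF ε hε
      have h2 : 1 / ((n:ℝ) + 2) < 1 := by
        rw [div_lt_one (by positivity)]
        have : (0:ℝ) ≤ n := Nat.cast_nonneg n
        linarith
      have h3 : 0 < 1 / ((n:ℝ) + 2) := by positivity
      obtain ⟨F', r, ε', a1, a2, a3, a4, a5, a6⟩ := step φ lam hmeas hper hbdd hnonneg heven hdec
        hAI1 hAI2 hlampos hlam0 hγ hg hF hε (τ := 1 - 1 / ((n:ℝ) + 2)) ⟨by linarith, by linarith⟩
      exact ⟨F', r, ε', a1, a3, a4, a5, fun G hG hv => ⟨a2, a6 G hG hv⟩⟩)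
  refine ⟨E, hE, hEs, fun x => ⟨γ / 4, by positivity, ?_⟩⟩
  have ht : Tendsto r atTop (𝓝[<] (1:ℝ)) := by
    refine tendsto_nhdsWithin_iff.2 ⟨?_, Eventually.of_forall fun n => (hr n).1.2⟩
    have h1 : Tendsto (fun n : ℕ => 1 - 1 / ((n:ℝ) + 2)) atTop (𝓝 (1 - 0)) := by
      refine tendsto_const_nhds.sub (tendsto_const_nhds.div_atTop ?_)
      exact tendsto_atTop_add_const_right _ _ tendsto_natCast_atTop_atTop
    rw [sub_zero] at h1
    exact tendsto_of_tendsto_of_tendsto_of_le_of_le h1 tendsto_const_nhds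
      (fun n => (hr n).1.1.le) (fun n => (hr n).1.2.le)
  exact ht.frequently (Frequently.of_forall fun n => (hr n).2 x)
end

section
/- Let n ∈ ℕ, 0 < δ < 1/2, and U_n^δ = ⋃_{k=0}^{n-1} (π(2k+1-δ)/n, π(2k+1+δ)/n) ⊂ 𝕋. Let J ⊂ 𝕋 be a closed interval with 16π/n ≤ |J| < π, and let E ⊂ 𝕋 be measurable with either E ∩ J = J ∩ U_n^δ or E ∩ J = J \ U_n^δ. Let φ ∈ L^∞(𝕋) be nonnegative, even, and decreasing on [0,π] with ∫_𝕋 φ ≤ 1. Then for every x ∈ J, osc_{θ∈[x-4π/n, x+4π/n]} ∫_𝕋 φ(θ-t) 𝟙_E(t) dt > ∫_{-πδ/n}^{πδ/n} φ(t) dt - 16δ - 2π·φ(|J|/4). -/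
open MeasureTheory Real Set

lemma aux_ii {g : ℝ → ℝ} (hg : Measurable g) {M : ℝ} (hM : ∀ t, |g t| ≤ M) (p q : ℝ) :
    IntervalIntegrable g volume p q := by
  refine (intervalIntegrable_const (c := M)).mono_fun hg.aestronglyMeasurable ?_
  refine Filter.Eventually.of_forall fun t => ?_
  have := hM t
  simp only [Real.norm_eq_abs]
  exact this.trans (le_abs_self M)

lemma aux_ind {p q A : ℝ} (g : ℝ → ℝ) (hp : 0 ≤ p) (hpq : p ≤ q) (hq : q ≤ A) :
    ∫ t in (0:ℝ)..A, (Ioo p q).indicator g t = ∫ t in p..q, g t := by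
  rw [intervalIntegral.integral_of_le (by linarith), intervalIntegral.integral_of_le hpq,
    setIntegral_indicator measurableSet_Ioo, integral_Ioc_eq_integral_Ioo]
  congr 2
  ext t
  simp only [mem_inter_iff, mem_Ioc, mem_Ioo]
  constructor
  · exact fun h => h.2
  · exact fun h => ⟨⟨by linarith [h.1], by linarith [h.2]⟩, h⟩

lemma aux_tooth {g : ℝ → ℝ} (hg : Measurable g) {M : ℝ} (hM : ∀ t, |g t| ≤ M)
    (h0 : ∀ t, 0 ≤ g t) {p q p' q' A B v w δ : ℝ} (hw : 0 < w) (hδ : 0 < δ)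
    (hpq : q - p = 2 * w * δ) (hpq' : q' - p' = w / 2) (hA : A ≤ p') (hB : q' ≤ B)
    (hv : ∀ t ∈ Icc p q, g t ≤ v) (hv' : ∀ t ∈ Icc p' q', v ≤ g t) :
    ∫ t in p..q, g t ≤ 4 * δ * ∫ t in A..B, g t := by
  have hwd : 0 < w * δ := mul_pos hw hδ
  have h1 : ∫ t in p..q, g t ≤ (q - p) * v := by
    have := intervalIntegral.integral_mono_on (by linarith) (aux_ii hg hM p q)
      (intervalIntegrable_const (c := v)) hv
    simpa using this
  have h2 : (q' - p') * v ≤ ∫ t in p'..q', g t := by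
    have := intervalIntegral.integral_mono_on (by linarith)
      (intervalIntegrable_const (c := v)) (aux_ii hg hM p' q') hv'
    simpa using this
  have h3 : ∫ t in p'..q', g t ≤ ∫ t in A..B, g t :=
    intervalIntegral.integral_mono_interval hA (by linarith) hB
      (Filter.Eventually.of_forall h0) (aux_ii hg hM A B)
  rw [hpq] at h1
  rw [hpq'] at h2
  have : 4 * δ * (w / 2 * v) ≤ 4 * δ * ∫ t in A..B, g t :=
    mul_le_mul_of_nonneg_left (h2.trans h3) (by linarith)
  calc _ ≤ _ := h1
    _ = 4 * δ * (w / 2 * v) := by ring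
    _ ≤ _ := this

lemma aux_sum {Ψ : ℝ → ℝ} (hg : Measurable Ψ) {M : ℝ} (hM : ∀ t, |Ψ t| ≤ M)
    (h0 : ∀ t, 0 ≤ Ψ t) (hanti : ∀ s s', |s| ≤ |s'| → Ψ s' ≤ Ψ s)
    (hint : Integrable Ψ) (hI : ∫ t, Ψ t ≤ 1) {w δ : ℝ} (hw : 0 < w) (hδ : 0 < δ)
    (hδ' : δ < 1 / 2) (n m : ℕ) :
    ∑ k ∈ Finset.range n, ∫ t in (w * (2 * (k:ℝ) + 1 - δ))..(w * (2 * (k:ℝ) + 1 + δ)),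
      Ψ (w * (2 * (m:ℝ)) - t) ≤ 4 * δ := by
  set θ := w * (2 * (m:ℝ)) with hθ
  have hg' : Measurable (fun t => Ψ (θ - t)) := hg.comp (measurable_const.sub measurable_id)
  have hM' : ∀ t, |Ψ (θ - t)| ≤ M := fun t => hM _
  have key : ∀ k ∈ Finset.range n,
      ∫ t in (w * (2 * (k:ℝ) + 1 - δ))..(w * (2 * (k:ℝ) + 1 + δ)), Ψ (θ - t)
      ≤ 4 * δ * ∫ t in (w * (2 * (k:ℝ)))..(w * (2 * ((k + 1 : ℕ):ℝ))), Ψ (θ - t) := by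
    intro k _
    have hwd : w * δ < w / 2 := by nlinarith
    have hwd0 : 0 < w * δ := mul_pos hw hδ
    rcases le_or_gt m k with hmk | hmk
    · have hmk' : w * (m:ℝ) ≤ w * k := by gcongr
      refine aux_tooth hg' hM' (fun t => h0 _) (p' := w * (2 * (k:ℝ)))
        (q' := w * (2 * (k:ℝ)) + w / 2) (v := Ψ (θ - (w * (2 * (k:ℝ)) + w / 2))) hw hδ
        (by ring) (by ring) le_rfl (by push_cast; linarith) ?_ ?_
      · intro t ht
        apply hanti
        rw [abs_of_nonpos (by linarith), abs_of_nonpos (by linarith [ht.1])]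
        linarith [ht.1]
      · intro t ht
        apply hanti
        rw [abs_of_nonpos (by linarith [ht.1]), abs_of_nonpos (by linarith [ht.1])]
        linarith [ht.2]
    · have hmk' : w * ((k:ℝ) + 1) ≤ w * m := by
        gcongr; exact_mod_cast hmk
      refine aux_tooth hg' hM' (fun t => h0 _) (p' := w * (2 * (k:ℝ)) + 3 * w / 2)
        (q' := w * (2 * (k:ℝ)) + 2 * w) (v := Ψ (θ - (w * (2 * (k:ℝ)) + 3 * w / 2))) hw hδ
        (by ring) (by ring) (by linarith) (by push_cast; linarith) ?_ ?_
      · intro t ht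
        apply hanti
        rw [abs_of_nonneg (by linarith), abs_of_nonneg (by linarith [ht.2])]
        linarith [ht.2]
      · intro t ht
        apply hanti
        rw [abs_of_nonneg (by linarith [ht.2]), abs_of_nonneg (by linarith [ht.2])]
        linarith [ht.1]
  refine (Finset.sum_le_sum key).trans ?_
  rw [← Finset.mul_sum, intervalIntegral.sum_integral_adjacent_intervals
    (a := fun k : ℕ => w * (2 * (k:ℝ))) (fun k _ => aux_ii hg' hM' _ _)]
  have : ∫ t in (w * (2 * ((0:ℕ):ℝ)))..(w * (2 * (n:ℝ))), Ψ (θ - t) ≤ 1 := by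
    rw [intervalIntegral.integral_comp_sub_left (fun t => Ψ t),
      intervalIntegral.integral_of_le (by
        have : 0 ≤ w * (n:ℝ) := by positivity
        push_cast; linarith)]
    exact (setIntegral_le_integral hint (Filter.Eventually.of_forall h0)).trans hI
  nlinarith

lemma aux_mono {φ : ℝ → ℝ} (heven : ∀ t, φ (-t) = φ t) (hdec : AntitoneOn φ (Set.Icc 0 π))
    {s s' : ℝ} (h : |s| ≤ |s'|) (h' : |s'| ≤ π) : φ s' ≤ φ s := by
  have e : ∀ u, φ u = φ |u| := by
    intro u
    rcases abs_cases u with h | h <;> rw [h.1]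
    rw [heven]
  rw [e s, e s']
  exact hdec ⟨abs_nonneg _, h.trans h'⟩ ⟨abs_nonneg _, h'⟩ h

lemma aux_refl {φ : ℝ → ℝ} (hper : ∀ t, φ (t + 2 * π) = φ t) (heven : ∀ t, φ (-t) = φ t)
    (s : ℝ) : φ (2 * π - s) = φ s := by
  rw [← heven s, ← hper (-s)]
  congr 1
  ring

lemma aux_far {φ : ℝ → ℝ} (hper : ∀ t, φ (t + 2 * π) = φ t) (heven : ∀ t, φ (-t) = φ t)
    (hdec : AntitoneOn φ (Set.Icc 0 π))
    {s c : ℝ} (hc : 0 ≤ c) (h : c ≤ s) (h' : s ≤ 2 * π - c) : φ s ≤ φ c := by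
  rcases le_or_gt s π with h1 | h1
  · exact hdec ⟨hc, by linarith⟩ ⟨by linarith, h1⟩ h
  · rw [← aux_refl hper heven s]
    exact hdec ⟨hc, by linarith⟩ ⟨by linarith, by linarith⟩ (by linarith)

lemma aux_left {φ : ℝ → ℝ} (hper : ∀ t, φ (t + 2 * π) = φ t) (heven : ∀ t, φ (-t) = φ t)
    (hdec : AntitoneOn φ (Set.Icc 0 π)) (hnonneg : ∀ t, 0 ≤ φ t) {a b c θ θ' t : ℝ}
    (ha : 0 ≤ a) (hb : b < 2 * π) (hc : 0 ≤ c) (hc' : c ≤ π)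
    (h1 : a ≤ θ) (h2 : θ < θ') (h3 : θ' + c ≤ b) (ht : t ∈ Ico 0 (2 * π)) (htJ : t ∉ Icc a b) :
    φ (θ' - t) - φ c ≤ φ (θ - t) := by
  obtain ⟨ht0, ht1⟩ := ht
  rcases lt_or_ge t a with hta | hta
  · rcases lt_or_ge (θ' - t) c with h | h
    · have : φ (θ' - t) ≤ φ (θ - t) := hdec ⟨by linarith, by linarith⟩
        ⟨by linarith, by linarith⟩ (by linarith)
      linarith [hnonneg c]
    · have := aux_far hper heven hdec hc h (by linarith)
      linarith [hnonneg (θ - t)]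
  · have htb : b < t := by
      by_contra hh
      exact htJ ⟨hta, not_lt.mp hh⟩
    have e1 : φ (θ' - t) = φ (t - θ') := by rw [← heven]; congr 1; ring
    have e2 : φ (θ - t) = φ (t - θ) := by rw [← heven]; congr 1; ring
    rw [e1, e2]
    rcases le_or_gt (t - θ') (2 * π - c) with h | h
    · have := aux_far hper heven hdec hc (by linarith) h
      linarith [hnonneg (t - θ)]
    · rw [← aux_refl hper heven (t - θ'), ← aux_refl hper heven (t - θ)]
      have : φ (2 * π - (t - θ')) ≤ φ (2 * π - (t - θ)) := hdec ⟨by linarith, by linarith⟩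
        ⟨by linarith, by linarith⟩ (by linarith)
      linarith [hnonneg c]

lemma aux_right {φ : ℝ → ℝ} (hper : ∀ t, φ (t + 2 * π) = φ t) (heven : ∀ t, φ (-t) = φ t)
    (hdec : AntitoneOn φ (Set.Icc 0 π)) (hnonneg : ∀ t, 0 ≤ φ t) {a b c θ θ' t : ℝ}
    (ha : 0 ≤ a) (hb : b < 2 * π) (hc : 0 ≤ c) (hc' : c ≤ π)
    (h1 : θ ≤ b) (h2 : θ' < θ) (h3 : a + c ≤ θ') (ht : t ∈ Ico 0 (2 * π)) (htJ : t ∉ Icc a b) :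
    φ (θ' - t) - φ c ≤ φ (θ - t) := by
  obtain ⟨ht0, ht1⟩ := ht
  rcases lt_or_ge t a with hta | hta
  · rcases le_or_gt (θ' - t) (2 * π - c) with h | h
    · have := aux_far hper heven hdec hc (by linarith) h
      linarith [hnonneg (θ - t)]
    · rw [← aux_refl hper heven (θ' - t), ← aux_refl hper heven (θ - t)]
      have : φ (2 * π - (θ' - t)) ≤ φ (2 * π - (θ - t)) := hdec ⟨by linarith, by linarith⟩
        ⟨by linarith, by linarith⟩ (by linarith)
      linarith [hnonneg c]
  · have htb : b < t := by
      by_contra hh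
      exact htJ ⟨hta, not_lt.mp hh⟩
    have e1 : φ (θ' - t) = φ (t - θ') := by rw [← heven]; congr 1; ring
    have e2 : φ (θ - t) = φ (t - θ) := by rw [← heven]; congr 1; ring
    rw [e1, e2]
    rcases lt_or_ge (t - θ') c with h | h
    · have : φ (t - θ') ≤ φ (t - θ) := hdec ⟨by linarith, by linarith⟩
        ⟨by linarith, by linarith⟩ (by linarith)
      linarith [hnonneg c]
    · have := aux_far hper heven hdec hc h (by linarith)
      linarith [hnonneg (t - θ)]

/-- Case where `E` agrees with the comb on `J`, at good points. -/
lemma aux_main {φ : ℝ → ℝ} (n : ℕ) {δ w : ℝ} (hδ : 0 < δ) (hδ' : δ < 1 / 2) (hw : 0 < w)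
    {a b c : ℝ} (ha : 0 ≤ a) (hb : b < 2 * π) (hJ : b - a < π)
    {E : Set ℝ} (hEmeas : MeasurableSet E)
    (hEJ : E ∩ Icc a b = Icc a b ∩ ⋃ k ∈ Finset.range n,
      Ioo (w * (2 * (k : ℝ) + 1 - δ)) (w * (2 * (k : ℝ) + 1 + δ)))
    (hnw : w * (2 * (n : ℝ)) = 2 * π)
    (hmeas : Measurable φ) (hbdd : ∃ M, ∀ t, |φ t| ≤ M)
    (hnonneg : ∀ t, 0 ≤ φ t) (heven : ∀ t, φ (-t) = φ t)
    (hdec : AntitoneOn φ (Set.Icc 0 π)) (hnorm : (∫ t in (-π)..π, φ t) ≤ 1)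
    (k₀ m : ℕ) (hk₀ : k₀ < n) (hl : a ≤ w * (2 * (k₀ : ℝ) + 1 - δ))
    (hr : w * (2 * (k₀ : ℝ) + 1 + δ) ≤ b)
    (hm : w * (2 * (m:ℝ)) ∈ Icc a b)
    (hout : ∀ t ∈ E, t ∉ Icc a b →
      φ (w * (2 * (m:ℝ)) - t) - φ c ≤ φ (w * (2 * (k₀:ℝ) + 1) - t)) :
    (∫ t in (0 : ℝ)..(2 * π), φ (w * (2 * (k₀:ℝ) + 1) - t) * E.indicator (fun _ => (1 : ℝ)) t) -
    (∫ t in (0 : ℝ)..(2 * π), φ (w * (2 * (m:ℝ)) - t) * E.indicator (fun _ => (1 : ℝ)) t) >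
    (∫ t in (-(w * δ))..(w * δ), φ t) - 16 * δ - 2 * π * φ c := by
  obtain ⟨M, hM⟩ := hbdd
  have hπ := Real.pi_pos
  have hM0 : 0 ≤ M := (abs_nonneg _).trans (hM 0)
  have hwd : 0 < w * δ := mul_pos hw hδ
  set Ψ : ℝ → ℝ := (Icc (-π) π).indicator φ with hΨ
  have hΨm : Measurable Ψ := hmeas.indicator measurableSet_Icc
  have hΨ0 : ∀ t, 0 ≤ Ψ t := fun t => indicator_nonneg (fun t _ => hnonneg t) t
  have hΨM : ∀ t, |Ψ t| ≤ M := by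
    intro t
    by_cases h : t ∈ Icc (-π) π
    · rw [hΨ, indicator_of_mem h]; exact hM t
    · rw [hΨ, indicator_of_notMem h]; simpa using hM0
  have hΨi : Integrable Ψ := by
    rw [hΨ, integrable_indicator_iff measurableSet_Icc]
    rw [← intervalIntegrable_iff_integrableOn_Icc_of_le (by linarith)]
    exact aux_ii hmeas hM _ _
  have hΨ1 : ∫ t, Ψ t ≤ 1 := by
    rw [hΨ, integral_indicator measurableSet_Icc, integral_Icc_eq_integral_Ioc,
      ← intervalIntegral.integral_of_le (by linarith)]
    exact hnorm
  have hΨanti : ∀ s s', |s| ≤ |s'| → Ψ s' ≤ Ψ s := by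
    intro s s' h
    by_cases h' : s' ∈ Icc (-π) π
    · have h2 : |s'| ≤ π := abs_le.mpr h'
      have h3 : s ∈ Icc (-π) π := abs_le.mp (h.trans h2)
      rw [hΨ, indicator_of_mem h', indicator_of_mem h3]
      exact aux_mono heven hdec h h2
    · rw [hΨ, indicator_of_notMem h']
      exact hΨ0 s
  have hsum := aux_sum hΨm hΨM hΨ0 hΨanti hΨi hΨ1 hw hδ hδ' n m
  set θ := w * (2 * (k₀:ℝ) + 1) with hθ
  set θ' := w * (2 * (m:ℝ)) with hθ'
  have mφ : ∀ u, Measurable (fun t => φ (u - t)) := fun u =>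
    hmeas.comp (measurable_const.sub measurable_id)
  have mΨ : ∀ u, Measurable (fun t => Ψ (u - t)) := fun u =>
    hΨm.comp (measurable_const.sub measurable_id)
  have iE : ∀ u, IntervalIntegrable (fun t => φ (u - t) * E.indicator (fun _ => (1 : ℝ)) t)
      volume 0 (2 * π) := by
    intro u
    refine aux_ii (M := M) ((mφ u).mul (measurable_const.indicator hEmeas)) ?_ _ _
    intro t
    by_cases h : t ∈ E
    · simpa [h] using hM _
    · simpa [h] using hM0
  have iInd : ∀ (g : ℝ → ℝ) (p q : ℝ), Measurable g → (∀ t, |g t| ≤ M) →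
      IntervalIntegrable ((Ioo p q).indicator g) volume 0 (2 * π) := by
    intro g p q hg hgM
    refine aux_ii (M := M) (hg.indicator measurableSet_Ioo) ?_ _ _
    intro t
    by_cases h : t ∈ Ioo p q
    · rw [indicator_of_mem h]; exact hgM t
    · rw [indicator_of_notMem h]; simpa using hM0
  set T : ℕ → Set ℝ := fun k => Ioo (w * (2 * (k : ℝ) + 1 - δ)) (w * (2 * (k : ℝ) + 1 + δ)) with hT
  have iS : IntervalIntegrable (fun t => ∑ k ∈ Finset.range n,
      (T k).indicator (fun t => Ψ (θ' - t)) t) volume 0 (2 * π) := by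
    have := IntervalIntegrable.sum (μ := volume) (a := 0) (b := 2 * π) (Finset.range n)
      (f := fun k => (T k).indicator (fun t => Ψ (θ' - t)))
      (fun k _ => iInd _ _ _ (mΨ θ') (fun t => hΨM _))
    have e : (fun t => ∑ k ∈ Finset.range n, (T k).indicator (fun t => Ψ (θ' - t)) t) =
        ∑ k ∈ Finset.range n, (T k).indicator (fun t => Ψ (θ' - t)) := by
      ext t
      rw [Finset.sum_apply]
    rw [e]
    exact this
  have iT := iInd (fun t => φ (θ - t)) (w * (2 * (k₀ : ℝ) + 1 - δ)) (w * (2 * (k₀ : ℝ) + 1 + δ))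
    (mφ θ) (fun t => hM _)
  have eT : ∫ t in (0:ℝ)..(2 * π), (T k₀).indicator (fun t => φ (θ - t)) t
      = ∫ t in (-(w * δ))..(w * δ), φ t := by
    rw [hT, aux_ind _ (by linarith) (by linarith) (by linarith),
      intervalIntegral.integral_comp_sub_left (fun t => φ t)]
    congr 1 <;> rw [hθ] <;> ring
  have eS : ∫ t in (0:ℝ)..(2 * π), ∑ k ∈ Finset.range n,
      (T k).indicator (fun t => Ψ (θ' - t)) t ≤ 4 * δ := by
    rw [intervalIntegral.integral_finsetSum
      (fun k _ => iInd _ _ _ (mΨ θ') (fun t => hΨM _))]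
    refine le_trans (le_of_eq (Finset.sum_congr rfl fun k hk => ?_)) hsum
    have hk' : (k:ℝ) + 1 ≤ n := by exact_mod_cast Finset.mem_range.mp hk
    have hk'' : w * ((k:ℝ) + 1) ≤ w * n := by gcongr
    have hk0 : 0 ≤ w * (k:ℝ) := by positivity
    have : w * δ < w / 2 := by nlinarith
    exact aux_ind _ (by linarith) (by linarith) (by linarith)
  have hmono : ∫ t in (0:ℝ)..(2 * π), ((T k₀).indicator (fun t => φ (θ - t)) t -
      (∑ k ∈ Finset.range n, (T k).indicator (fun t => Ψ (θ' - t)) t) - φ c) ≤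
      ∫ t in (0:ℝ)..(2 * π), (φ (θ - t) * E.indicator (fun _ => (1 : ℝ)) t -
        φ (θ' - t) * E.indicator (fun _ => (1 : ℝ)) t) := by
    refine intervalIntegral.integral_mono_on (by linarith)
      ((iT.sub iS).sub intervalIntegrable_const) ((iE θ).sub (iE θ')) ?_
    intro t _
    have hnn : ∀ k ∈ Finset.range n, 0 ≤ (T k).indicator (fun t => Ψ (θ' - t)) t :=
      fun k _ => indicator_nonneg (fun t _ => hΨ0 _) t
    have hsn := Finset.sum_nonneg hnn
    have hcn := hnonneg c
    have hTJ : t ∈ T k₀ → t ∈ Icc a b := fun h => ⟨by linarith [h.1], by linarith [h.2]⟩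
    have hTE : t ∈ T k₀ → t ∈ E := by
      intro h
      have : t ∈ E ∩ Icc a b := by
        rw [hEJ]
        exact ⟨hTJ h, mem_biUnion (Finset.mem_coe.mpr (Finset.mem_range.mpr hk₀)) h⟩
      exact this.1
    by_cases htE : t ∈ E
    · rw [indicator_of_mem htE]
      by_cases htJ : t ∈ Icc a b
      · have : t ∈ Icc a b ∩ ⋃ k ∈ Finset.range n, T k := by
          rw [← hEJ]; exact ⟨htE, htJ⟩
        obtain ⟨k, hk, hkt⟩ := mem_iUnion₂.mp this.2
        have h1 := Finset.single_le_sum hnn hk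
        rw [indicator_of_mem hkt] at h1
        have h2 : Ψ (θ' - t) = φ (θ' - t) := by
          rw [hΨ]
          have hmem : θ' - t ∈ Icc (-π) π := ⟨by linarith [htJ.1, htJ.2, hm.1, hm.2],
            by linarith [htJ.1, htJ.2, hm.1, hm.2]⟩
          exact indicator_of_mem hmem _
        have h3 : (T k₀).indicator (fun t => φ (θ - t)) t ≤ φ (θ - t) :=
          indicator_le_self' (fun _ _ => hnonneg _) t
        linarith
      · rw [indicator_of_notMem (fun h => htJ (hTJ h))]
        have := hout t htE htJ
        linarith
    · rw [indicator_of_notMem htE, indicator_of_notMem (fun h => htE (hTE h))]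
      linarith
  rw [intervalIntegral.integral_sub (iT.sub iS) intervalIntegrable_const,
    intervalIntegral.integral_sub iT iS, intervalIntegral.integral_sub (iE θ) (iE θ'),
    intervalIntegral.integral_const, eT] at hmono
  simp only [smul_eq_mul, sub_zero] at hmono
  linarith

/-- Lemma 3.1: oscillation estimate for convolutions against the
indicator of a set that agrees on a long interval `J` with the periodic comb
`U_n^δ = ⋃_k (π(2k+1-δ)/n, π(2k+1+δ)/n)` (or with its complement). -/
theorem comb_oscillation_estimate
    (n : ℕ) (hn : 1 ≤ n) (δ : ℝ) (hδ : δ ∈ Set.Ioo (0 : ℝ) (1 / 2))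
    (U : Set ℝ)
    (hU : U = ⋃ k ∈ Finset.range n,
      Set.Ioo (π * (2 * (k : ℝ) + 1 - δ) / n) (π * (2 * (k : ℝ) + 1 + δ) / n))
    (a b : ℝ) (ha : 0 ≤ a) (hb : b < 2 * π)
    (hJlen : 16 * π / n ≤ b - a) (hJlen' : b - a < π)
    (E : Set ℝ) (hEmeas : MeasurableSet E) (hE : E ⊆ Set.Ico 0 (2 * π))
    (hEJ : E ∩ Set.Icc a b = Set.Icc a b ∩ U ∨
           E ∩ Set.Icc a b = Set.Icc a b \ U)
    (φ : ℝ → ℝ)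
    (hmeas : Measurable φ) (hbdd : ∃ M, ∀ t, |φ t| ≤ M)
    (hper : ∀ t, φ (t + 2 * π) = φ t)
    (hnonneg : ∀ t, 0 ≤ φ t)
    (heven : ∀ t, φ (-t) = φ t)
    (hdec : AntitoneOn φ (Set.Icc 0 π))
    (hnorm : (∫ t in (-π)..π, φ t) ≤ 1) :
    ∀ x ∈ Set.Icc a b,
      ∃ θ θ', θ ∈ Set.Icc (x - 4 * π / n) (x + 4 * π / n) ∧
        θ' ∈ Set.Icc (x - 4 * π / n) (x + 4 * π / n) ∧
        (∫ t in (0 : ℝ)..(2 * π), φ (θ - t) * Set.indicator E (fun _ => (1 : ℝ)) t) -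
        (∫ t in (0 : ℝ)..(2 * π), φ (θ' - t) * Set.indicator E (fun _ => (1 : ℝ)) t) >
        (∫ t in (-(π * δ / n))..(π * δ / n), φ t) - 16 * δ - 2 * π * φ ((b - a) / 4) := by
  intro x hx
  obtain ⟨hδ0, hδ1⟩ := hδ
  have hπ := Real.pi_pos
  have hn0 : (0:ℝ) < n := by exact_mod_cast hn
  set w := π / n with hwdef
  have hw : 0 < w := by positivity
  have hnw : w * (2 * (n : ℝ)) = 2 * π := by rw [hwdef]; field_simp
  have hU' : U = ⋃ k ∈ Finset.range n,
      Ioo (w * (2 * (k : ℝ) + 1 - δ)) (w * (2 * (k : ℝ) + 1 + δ)) := by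
    rw [hU]
    simp only [hwdef, mul_div_right_comm]
  have e16 : 16 * π / n = 16 * w := by rw [hwdef]; ring
  have e4 : 4 * π / n = 4 * w := by rw [hwdef]; ring
  have eδ : π * δ / n = w * δ := by rw [hwdef]; ring
  rw [e16] at hJlen
  rw [e4, eδ]
  have hwd : w * δ < w / 2 := by nlinarith
  have hwd0 : 0 < w * δ := mul_pos hw hδ0
  have hxw : w * (x / w) = x := by field_simp
  obtain ⟨hxa, hxb⟩ := hx
  -- choice of good points
  have hpts : ∃ k₀ m : ℕ, w * (2 * (k₀ : ℝ) + 1) ∈ Icc (x - 4 * w) (x + 4 * w) ∧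
      w * (2 * (m : ℝ)) ∈ Icc (x - 4 * w) (x + 4 * w) ∧ w * (2 * (m : ℝ)) ∈ Icc a b ∧
      a ≤ w * (2 * (k₀ : ℝ) + 1 - δ) ∧ w * (2 * (k₀ : ℝ) + 1 + δ) ≤ b ∧
      ∀ t ∈ Ico 0 (2 * π), t ∉ Icc a b →
        φ (w * (2 * (m:ℝ)) - t) - φ ((b - a) / 4) ≤ φ (w * (2 * (k₀:ℝ) + 1) - t) := by
    rcases le_or_gt x ((a + b) / 2) with hmid | hmid
    · have hxw0 : 0 ≤ x / w := div_nonneg (by linarith) hw.le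
      set y := (x / w + 3 / 2) / 2 with hy
      have h1 : (⌊y⌋₊ : ℝ) ≤ y := Nat.floor_le (by positivity)
      have h2 : y < ⌊y⌋₊ + 1 := Nat.lt_floor_add_one y
      have h1' := mul_le_mul_of_nonneg_left h1 hw.le
      have h2' := mul_lt_mul_of_pos_left h2 hw
      have e : w * y = x / 2 + 3 / 4 * w := by rw [hy]; linear_combination hxw / 2
      rw [e] at h1' h2'
      refine ⟨⌊y⌋₊, ⌊y⌋₊ + 1, ?_, ?_, ?_, ?_, ?_, ?_⟩
      · constructor <;> linarith
      · push_cast; constructor <;> linarith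
      · push_cast; constructor <;> linarith
      · linarith
      · linarith
      · intro t ht htJ
        refine aux_left hper heven hdec hnonneg ha hb (by linarith) (by linarith)
          ?_ ?_ ?_ ht htJ <;> push_cast <;> linarith
    · have hxw0 : 3 / 2 ≤ x / w := by rw [le_div_iff₀ hw]; linarith
      set y := (x / w - 3 / 2) / 2 with hy
      have h1 : (⌊y⌋₊ : ℝ) ≤ y := Nat.floor_le (by linarith)
      have h2 : y < ⌊y⌋₊ + 1 := Nat.lt_floor_add_one y
      have h1' := mul_le_mul_of_nonneg_left h1 hw.le
      have h2' := mul_lt_mul_of_pos_left h2 hw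
      have e : w * y = x / 2 - 3 / 4 * w := by rw [hy]; linear_combination hxw / 2
      rw [e] at h1' h2'
      refine ⟨⌊y⌋₊, ⌊y⌋₊, ?_, ?_, ?_, ?_, ?_, ?_⟩
      · constructor <;> linarith
      · constructor <;> linarith
      · constructor <;> linarith
      · linarith
      · linarith
      · intro t ht htJ
        refine aux_right hper heven hdec hnonneg ha hb (by linarith) (by linarith)
          ?_ ?_ ?_ ht htJ <;> linarith
  obtain ⟨k₀, m, hθx, hθ'x, hm, hl, hr, hout⟩ := hpts
  have hk₀ : k₀ < n := by
    have : w * (2 * (k₀:ℝ)) < w * (2 * n) := by linarith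
    have h2 := lt_of_mul_lt_mul_left this hw.le
    have h3 : (k₀:ℝ) < n := by linarith
    exact_mod_cast h3
  rcases hEJ with hEJ | hEJ
  · rw [hU'] at hEJ
    exact ⟨_, _, hθx, hθ'x, aux_main n hδ0 hδ1 hw ha hb hJlen' hEmeas hEJ hnw hmeas hbdd hnonneg
      heven hdec hnorm k₀ m hk₀ hl hr hm (fun t ht => hout t (hE ht))⟩
  · have hEc : (Ico 0 (2 * π) \ E) ∩ Icc a b = Icc a b ∩ U := by
      ext t
      have := Set.ext_iff.mp hEJ t
      simp only [mem_inter_iff, mem_diff] at this ⊢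
      constructor
      · rintro ⟨⟨h1, h2⟩, h3⟩
        refine ⟨h3, ?_⟩
        by_contra h4
        exact h2 (this.mpr ⟨h3, h4⟩).1
      · rintro ⟨h1, h2⟩
        exact ⟨⟨⟨by linarith [h1.1], by linarith [h1.2]⟩, fun h => (this.mp ⟨h, h1⟩).2 h2⟩, h1⟩
    rw [hU'] at hEc
    have hmain := aux_main n hδ0 hδ1 hw ha hb hJlen' (measurableSet_Ico.diff hEmeas) hEc hnw hmeas
      hbdd hnonneg heven hdec hnorm k₀ m hk₀ hl hr hm (fun t ht => hout t ht.1)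
    refine ⟨_, _, hθ'x, hθx, ?_⟩
    obtain ⟨M, hM⟩ := hbdd
    have hM0 : 0 ≤ M := (abs_nonneg _).trans (hM 0)
    have hcompl : ∀ u, (∫ t in (0 : ℝ)..(2 * π), φ (u - t) *
        (Ico 0 (2 * π) \ E).indicator (fun _ => (1 : ℝ)) t) = (∫ t in (-π)..π, φ t) -
        ∫ t in (0 : ℝ)..(2 * π), φ (u - t) * E.indicator (fun _ => (1 : ℝ)) t := by
      intro u
      have mφ : Measurable (fun t => φ (u - t)) :=
        hmeas.comp (measurable_const.sub measurable_id)
      have iE : IntervalIntegrable (fun t => φ (u - t) * E.indicator (fun _ => (1 : ℝ)) t)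
          volume 0 (2 * π) := by
        refine aux_ii (M := M) (mφ.mul (measurable_const.indicator hEmeas)) ?_ _ _
        intro t
        by_cases h : t ∈ E
        · simpa [h] using hM _
        · simpa [h] using hM0
      have hfull : ∫ t in (0:ℝ)..(2 * π), φ (u - t) = ∫ t in (-π)..π, φ t := by
        rw [intervalIntegral.integral_comp_sub_left (fun t => φ t)]
        have hp : Function.Periodic φ (2 * π) := hper
        have := hp.intervalIntegral_add_eq (u - 2 * π) (-π)
        rw [show u - 2 * π + 2 * π = u - 0 by ring, show -π + 2 * π = π by ring] at this
        exact this
      rw [← hfull, ← intervalIntegral.integral_sub (aux_ii mφ (fun t => hM _) _ _) iE]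
      rw [intervalIntegral.integral_of_le (by linarith),
        intervalIntegral.integral_of_le (by linarith), integral_Ioc_eq_integral_Ioo,
        integral_Ioc_eq_integral_Ioo]
      refine setIntegral_congr_fun measurableSet_Ioo fun t ht => ?_
      have ht' : t ∈ Ico 0 (2 * π) := ⟨ht.1.le, ht.2⟩
      by_cases h : t ∈ E
      · have h2 : t ∉ Ico 0 (2 * π) \ E := fun hh => hh.2 h
        simp only [indicator_of_mem h, indicator_of_notMem h2]
        ring
      · have h2 : t ∈ Ico 0 (2 * π) \ E := ⟨ht', h⟩
        simp only [indicator_of_notMem h, indicator_of_mem h2]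
        ring
    rw [hcompl, hcompl] at hmain
    linarith
end
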